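/- Let f be a natural number with n = 3f+1, and let B ⊆ ZMod n be a set of byzantine positions with |B| ≤ f. Then there exists i : ZMod n such that i ∉ B, i+1 ∉ B, and i+2 ∉ B; i.e., any circular arrangement of 3f+1 nodes containing at most f byzantine nodes contains three consecutive honest nodes. -/

import Mathlib

/-- In a circle of `3f+1` nodes with at most `f` byzantine nodes, there exist
three consecutive honest nodes. -/
theorem three_consecutive_honest_circle (f : ℕ)
    (B : Finset (ZMod (3 * f + 1))) (hB : B.card ≤ f) :
    ∃ i : ZMod (3 * f + 1), i ∉ B ∧ i + 1 ∉ B ∧ i + 2 ∉ B := by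
  have hcard : (B ∪ B.image (· - 1) ∪ B.image (· - 2)).card <
      Fintype.card (ZMod (3 * f + 1)) := by
    have h₁ := Finset.card_union_le (B ∪ B.image (· - 1)) (B.image (· - 2))
    have h₂ := Finset.card_union_le B (B.image (· - 1))
    have h₃ := Finset.card_image_le (s := B) (f := (· - 1))
    have h₄ := Finset.card_image_le (s := B) (f := (· - 2))
    rw [ZMod.card]
    omega
  obtain ⟨i, hi⟩ : ∃ i, i ∉ B ∪ B.image (· - 1) ∪ B.image (· - 2) := by
    by_contra! h
    exact hcard.ne (Finset.card_eq_iff_eq_univ _ |>.2 (Finset.eq_univ_iff_forall.2 h))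
  simp only [Finset.mem_union, not_or] at hi
  exact ⟨i, hi.1.1,
    fun h => hi.1.2 (Finset.mem_image.2 ⟨i + 1, h, add_sub_cancel_right i 1⟩),
    fun h => hi.2 (Finset.mem_image.2 ⟨i + 2, h, add_sub_cancel_right i 2⟩)⟩
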